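/- Let F be the free group on a set S, let w ∈ F be a nontrivial positive word (i.e. w lies in the submonoid generated by the generators S, with no inverse generators), and suppose the one-relator group G = F/⟪w⟫ is torsion-free. Then G has a normal subgroup N that is a free group with G/N ℚ-solvable, and consequently G is residually ℚ-solvable. -/

import Mathlib

def ratDerived (G : Type*) [Group G] : ℕ → Subgroup G
  | 0 => ⊤
  | i + 1 =>
      Subgroup.closure
        {g | g ∈ ratDerived G i ∧
          ∃ k : ℕ, 1 ≤ k ∧ g ^ k ∈ ⁅ratDerived G i, ratDerived G i⁆}

instance ratDerived_normal (G : Type*) [Group G] (i : ℕ) : (ratDerived G i).Normal := by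
  induction i with
  | zero =>
    show (⊤ : Subgroup G).Normal
    infer_instance
  | succ i ih =>
    haveI := ih
    constructor
    intro x hx g
    have himg : (fun y => g * y * g⁻¹) ''
        {y | y ∈ ratDerived G i ∧ ∃ k : ℕ, 1 ≤ k ∧ y ^ k ∈ ⁅ratDerived G i, ratDerived G i⁆} ⊆
        {y | y ∈ ratDerived G i ∧ ∃ k : ℕ, 1 ≤ k ∧ y ^ k ∈ ⁅ratDerived G i, ratDerived G i⁆} := by
      rintro _ ⟨y, ⟨hy, k, hk, hyk⟩, rfl⟩
      refine ⟨ih.conj_mem y hy g, k, hk, ?_⟩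
      rw [conj_pow]
      exact (Subgroup.commutator_normal _ _).conj_mem _ hyk g
    have hmap : (ratDerived G (i + 1)).map (MulAut.conj g).toMonoidHom ≤ ratDerived G (i + 1) := by
      show (Subgroup.closure _).map _ ≤ Subgroup.closure _
      rw [MonoidHom.map_closure]
      refine (Subgroup.closure_le _).2 (fun y hy => Subgroup.subset_closure (himg ?_))
      simpa using hy
    exact hmap ⟨x, hx, rfl⟩

def ratDerivedOmega (G : Type*) [Group G] : Subgroup G := ⨅ i, ratDerived G i

instance ratDerivedOmega_normal (G : Type*) [Group G] : (ratDerivedOmega G).Normal := by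
  constructor
  intro x hx g
  simp only [ratDerivedOmega, Subgroup.mem_iInf] at hx ⊢
  exact fun i => (ratDerived_normal G i).conj_mem x (hx i) g

def QSolvable (G : Type*) [Group G] : Prop := ∃ n : ℕ, ratDerived G n = ⊥

def ResiduallyQSolvable (G : Type*) [Group G] : Prop := ratDerivedOmega G = ⊥

section RationalDerivedSeries

open scoped commutatorElement

variable {G : Type*} [Group G]

theorem mem_ratDerived_succ {i : ℕ} {g : G} :
    g ∈ ratDerived G (i + 1) ↔
      g ∈ ratDerived G i ∧ ∃ k : ℕ, 1 ≤ k ∧ g ^ k ∈ ⁅ratDerived G i, ratDerived G i⁆ := by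
  constructor
  · intro hg
    change g ∈ Subgroup.closure _ at hg
    induction hg using Subgroup.closure_induction with
    | mem x hx => exact hx
    | one => exact ⟨one_mem _, 1, le_rfl, by simp⟩
    | mul x y _ _ hx hy =>
      obtain ⟨hx, k, hk, hxk⟩ := hx
      obtain ⟨hy, m, hm, hym⟩ := hy
      refine ⟨mul_mem hx hy, k * m, Nat.mul_pos hk hm, ?_⟩
      rw [← QuotientGroup.eq_one_iff] at hxk hym ⊢
      have hcomm : Commute (x : G ⧸ ⁅ratDerived G i, ratDerived G i⁆) y := by
        rw [← commutatorElement_eq_one_iff_commute]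
        exact (QuotientGroup.eq_one_iff ⁅x, y⁆).2 (Subgroup.commutator_mem_commutator hx hy)
      rw [QuotientGroup.mk_pow] at hxk hym
      rw [QuotientGroup.mk_pow, QuotientGroup.mk_mul]
      rw [hcomm.mul_pow, pow_mul, hxk, mul_comm k m, pow_mul, hym]
      simp
    | inv x _ hx =>
      obtain ⟨hx, k, hk, hxk⟩ := hx
      exact ⟨inv_mem hx, k, hk, by rw [inv_pow]; exact inv_mem hxk⟩
  · intro hg
    exact Subgroup.subset_closure hg

theorem ratDerived_antitone : Antitone (ratDerived G) :=
  antitone_nat_of_succ_le fun _ _ hg => (mem_ratDerived_succ.1 hg).1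

theorem commutator_le_ratDerived_succ (i : ℕ) :
    ⁅ratDerived G i, ratDerived G i⁆ ≤ ratDerived G (i + 1) := fun g hg =>
  mem_ratDerived_succ.2 ⟨Subgroup.commutator_le_left _ _ hg, 1, le_rfl, by simpa using hg⟩

theorem mem_ratDerived_succ_of_pow {i k : ℕ} {g : G} (hg : g ∈ ratDerived G i) (hk : 1 ≤ k)
    (hgk : g ^ k ∈ ratDerived G (i + 1)) : g ∈ ratDerived G (i + 1) := by
  obtain ⟨-, m, hm, hgm⟩ := mem_ratDerived_succ.1 hgk
  exact mem_ratDerived_succ.2 ⟨hg, k * m, Nat.mul_pos hk hm, by rwa [pow_mul]⟩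

theorem map_ratDerived_le {H : Type*} [Group H] (f : G →* H) (i : ℕ) :
    (ratDerived G i).map f ≤ ratDerived H i := by
  induction i with
  | zero => exact le_top
  | succ i ih =>
    rintro _ ⟨g, hg, rfl⟩
    obtain ⟨hg, k, hk, hgk⟩ := mem_ratDerived_succ.1 hg
    refine mem_ratDerived_succ.2 ⟨ih ⟨g, hg, rfl⟩, k, hk, ?_⟩
    rw [← map_pow]
    refine Subgroup.commutator_mono ih ih ?_
    rw [← Subgroup.map_commutator]
    exact ⟨_, hgk, rfl⟩

theorem ratDerived_quotient_le {n k : ℕ} (hk : k ≤ n) :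
    ratDerived (G ⧸ ratDerived G n) k ≤
      (ratDerived G k).map (QuotientGroup.mk' (ratDerived G n)) := by
  induction k with
  | zero =>
    rintro x -
    obtain ⟨g, rfl⟩ := QuotientGroup.mk'_surjective _ x
    exact ⟨g, Subgroup.mem_top g, rfl⟩
  | succ k ih =>
    intro x hx
    obtain ⟨hx, m, hm, hxm⟩ := mem_ratDerived_succ.1 hx
    obtain ⟨g, hg, rfl⟩ := ih (by omega) hx
    refine ⟨g, mem_ratDerived_succ_of_pow hg hm ?_, rfl⟩
    have hmem := Subgroup.commutator_mono (ih (by omega)) (ih (by omega)) hxm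
    rw [← Subgroup.map_commutator] at hmem
    obtain ⟨c, hc, hcg⟩ := hmem
    rw [← map_pow] at hcg
    have hquot := ratDerived_antitone hk ((QuotientGroup.eq (s := ratDerived G n)).1 hcg)
    exact (mul_mem_cancel_left (inv_mem (commutator_le_ratDerived_succ k hc))).1 hquot

theorem qSolvable_quotient_ratDerived (n : ℕ) : QSolvable (G ⧸ ratDerived G n) := by
  refine ⟨n, eq_bot_iff.2 fun x hx => ?_⟩
  obtain ⟨g, hg, rfl⟩ := ratDerived_quotient_le le_rfl hx
  exact (QuotientGroup.eq_one_iff g).2 hg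

theorem ratDerived_add_le (n i : ℕ) :
    ratDerived G (n + i) ≤ (ratDerived (ratDerived G n) i).map (ratDerived G n).subtype := by
  induction i with
  | zero => exact fun g hg => ⟨⟨g, hg⟩, Subgroup.mem_top _, rfl⟩
  | succ i ih =>
    intro g hg
    obtain ⟨hg, k, hk, hgk⟩ := mem_ratDerived_succ.1 hg
    obtain ⟨x, hx, rfl⟩ := ih hg
    refine ⟨x, mem_ratDerived_succ.2 ⟨hx, k, hk, ?_⟩, rfl⟩
    have hmem := Subgroup.commutator_mono ih ih hgk
    rw [← Subgroup.map_commutator, ← map_pow] at hmem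
    obtain ⟨y, hy, hyx⟩ := hmem
    have : y = x ^ k := Subtype.ext hyx
    rwa [← this]

theorem residuallyQSolvable_of_ratDerived {n : ℕ} (h : ResiduallyQSolvable (ratDerived G n)) :
    ResiduallyQSolvable G := by
  refine eq_bot_iff.2 fun g hg => ?_
  have hg' : ∀ i, g ∈ ratDerived G i := by simpa [ratDerivedOmega] using hg
  have hmem : (⟨g, hg' n⟩ : ratDerived G n) ∈ ratDerivedOmega (ratDerived G n) := by
    refine Subgroup.mem_iInf.2 fun i => ?_
    obtain ⟨x, hx, hxg⟩ := ratDerived_add_le n i (hg' (n + i))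
    have : x = ⟨g, hg' n⟩ := Subtype.ext hxg
    rwa [← this]
  rw [show ratDerivedOmega (ratDerived G n) = ⊥ from h, Subgroup.mem_bot] at hmem
  exact congrArg Subtype.val hmem

theorem ResiduallyQSolvable.of_injective {H : Type*} [Group H] (hH : ResiduallyQSolvable H)
    (f : G →* H) (hf : Function.Injective f) : ResiduallyQSolvable G := by
  refine eq_bot_iff.2 fun g hg => ?_
  have hfg : f g ∈ ratDerivedOmega H :=
    Subgroup.mem_iInf.2 fun i => map_ratDerived_le f i ⟨g, (Subgroup.mem_iInf.1 hg i), rfl⟩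
  rw [show ratDerivedOmega H = ⊥ from hH, Subgroup.mem_bot] at hfg
  exact (map_eq_one_iff f hf).1 hfg

theorem ratDerived_succ_le_map_ker {A : Type*} [CommGroup A]
    (hA : ∀ (a : A) (k : ℕ), 1 ≤ k → a ^ k = 1 → a = 1) {i : ℕ} (φ : ratDerived G i →* A) :
    ratDerived G (i + 1) ≤ φ.ker.map (ratDerived G i).subtype := by
  intro g hg
  obtain ⟨hg, k, hk, hgk⟩ := mem_ratDerived_succ.1 hg
  refine ⟨⟨g, hg⟩, hA _ k hk ?_, rfl⟩
  have hle : ⁅ratDerived G i, ratDerived G i⁆ ≤ φ.ker.map (ratDerived G i).subtype := by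
    refine Subgroup.commutator_le.2 fun x hx y hy =>
      ⟨⁅(⟨x, hx⟩ : ratDerived G i), (⟨y, hy⟩ : ratDerived G i)⁆, ?_, rfl⟩
    change φ _ = 1
    rw [map_commutatorElement, commutatorElement_eq_one_iff_mul_comm, mul_comm]
  obtain ⟨y, hy, hyg⟩ := hle hgk
  have : y = ⟨g, hg⟩ ^ k := Subtype.ext hyg
  rw [← map_pow, ← this]
  exact hy

end RationalDerivedSeries

section Peeling

/-- The translates `P * q` of a finite set `P` can be well-founded in such a way that each of them
contains a point lying on no earlier translate. -/
def IsPeelable {Q : Type*} [Group Q] (P : Finset Q) : Prop :=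
  ∃ r : Q → Q → Prop, WellFounded r ∧
    ∀ q, ∃ p ∈ P, ∀ p' ∈ P, ∀ q', p * q = p' * q' → q' = q ∨ r q q'

variable {Q Q' : Type*} [Group Q] [Group Q']

theorem IsPeelable.of_subsingleton {P : Finset Q} (hP : P.Nonempty)
    (h : ∀ p ∈ P, ∀ p' ∈ P, p = p') : IsPeelable P := by
  obtain ⟨p, hp⟩ := hP
  refine ⟨emptyRelation, emptyWf.wf, fun q => ⟨p, hp, fun p' hp' q' hq => Or.inl ?_⟩⟩
  rw [h p hp p' hp'] at hq
  exact (mul_left_cancel hq).symm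

theorem IsPeelable.of_injective [DecidableEq Q'] (f : Q →* Q') (hf : Function.Injective f)
    {P : Finset Q} (h : IsPeelable (P.image f)) : IsPeelable P := by
  obtain ⟨r, hr, h⟩ := h
  refine ⟨InvImage r f, InvImage.wf f hr, fun q => ?_⟩
  obtain ⟨x, hx, h⟩ := h (f q)
  obtain ⟨p, hp, rfl⟩ := Finset.mem_image.1 hx
  refine ⟨p, hp, fun p' hp' q' hq => ?_⟩
  refine (h (f p') (Finset.mem_image_of_mem f hp') (f q') ?_).imp (fun h => hf h) id
  rw [← map_mul, ← map_mul, hq]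

theorem IsPeelable.of_hom [DecidableEq Q'] (φ : Q →* Q') {P : Finset Q}
    (h : IsPeelable (P.image φ)) (hK : ∀ T : Finset φ.ker, T.Nonempty → IsPeelable T) :
    IsPeelable P := by
  obtain ⟨r', hr', h'⟩ := h
  choose c hc hc' using h'
  choose p₀ hp₀ hp₀c using fun q' => Finset.mem_image.1 (hc q')
  let T : Q' → Finset φ.ker := fun q' =>
    P.preimage (fun k : φ.ker => p₀ q' * (k : Q))
      (fun a _ b _ hab => Subtype.ext (mul_left_cancel hab))
  have hT : ∀ q' (k : φ.ker), k ∈ T q' ↔ p₀ q' * (k : Q) ∈ P := fun q' k => Finset.mem_preimage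
  choose R hR hR' using fun q' => hK (T q') ⟨1, (hT q' 1).2 (by simpa using hp₀ q')⟩
  let t : Q' → Q := Function.invFun φ
  have ht : ∀ q, φ (t (φ q)) = φ q := fun q => Function.invFun_eq ⟨q, rfl⟩
  let k : Q → φ.ker := fun q => ⟨q * (t (φ q))⁻¹, by simp [MonoidHom.mem_ker, ht]⟩
  let e : Q → Σ' _ : Q', φ.ker := fun q => ⟨φ q, k q⟩
  have hwf : WellFounded (PSigma.Lex r' R) :=
    ⟨fun x => PSigma.lexAccessible (hr'.apply x.1) hR x.2⟩
  refine ⟨InvImage (PSigma.Lex r' R) e, InvImage.wf e hwf, fun q => ?_⟩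
  obtain ⟨τ, hτ, hτ'⟩ := hR' (φ q) (k q)
  refine ⟨p₀ (φ q) * τ, (hT _ _).1 hτ, fun p' hp' q₂ hq => ?_⟩
  have hτφ : φ τ = 1 := τ.2
  have hφ : c (φ q) * φ q = φ p' * φ q₂ := by
    rw [← map_mul, ← hq, map_mul, map_mul, hp₀c, hτφ, mul_one]
  rcases hc' (φ q) (φ p') (Finset.mem_image_of_mem φ hp') (φ q₂) hφ with hq₂ | hlt
  · have hp'c : φ p' = c (φ q) := by
      rw [hq₂] at hφ
      exact (mul_right_cancel hφ).symm
    let τ' : φ.ker := ⟨(p₀ (φ q))⁻¹ * p', by simp [MonoidHom.mem_ker, hp₀c, hp'c]⟩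
    have hτ'k : τ * k q = τ' * k q₂ := by
      apply Subtype.ext
      change (τ : Q) * (q * (t (φ q))⁻¹) = (p₀ (φ q))⁻¹ * p' * (q₂ * (t (φ q₂))⁻¹)
      rw [hq₂, mul_assoc _ p', ← mul_assoc p', ← hq]
      group
    rcases hτ' τ' ((hT _ _).2 (by simpa [τ'] using hp')) (k q₂) hτ'k with hk | hlt
    · left
      have := congrArg Subtype.val hk
      change q₂ * (t (φ q₂))⁻¹ = q * (t (φ q))⁻¹ at this
      rw [hq₂] at this
      exact mul_right_cancel this
    · right
      change PSigma.Lex r' R ⟨φ q, k q⟩ ⟨φ q₂, k q₂⟩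
      rw [hq₂]
      exact PSigma.Lex.right _ hlt
  · exact Or.inr (PSigma.Lex.left _ _ hlt)

theorem isPeelable_lattice {m : ℕ} (P : Finset (Multiplicative (Fin m → ℤ))) (hP : P.Nonempty) :
    IsPeelable P := by
  let N : (Fin m → ℤ) → ℤ := fun v => ∑ i, v i ^ 2
  have hN : ∀ v, 0 ≤ N v := fun v => Finset.sum_nonneg fun i _ => sq_nonneg _
  refine ⟨InvImage (· < ·) (fun q => (N q.toAdd).toNat), InvImage.wf _ wellFounded_lt,
    fun q => ?_⟩
  obtain ⟨p, hp, hmax⟩ := P.exists_max_image (fun p => ∑ i, p.toAdd i * q.toAdd i) hP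
  refine ⟨p, hp, fun p' hp' q' hq => ?_⟩
  have hq' : ∀ i, q'.toAdd i = q.toAdd i + (p.toAdd i - p'.toAdd i) := fun i => by
    have := congrFun (congrArg Multiplicative.toAdd hq) i
    simp only [toAdd_mul, Pi.add_apply] at this
    linarith
  by_cases hpp : p = p'
  · left
    rw [hpp] at hq
    exact (mul_left_cancel hq).symm
  right
  change (N q.toAdd).toNat < (N q'.toAdd).toNat
  have hpos : 0 < ∑ i, (p.toAdd i - p'.toAdd i) ^ 2 := by
    obtain ⟨i, hi⟩ := Function.ne_iff.1 (show p.toAdd ≠ p'.toAdd from fun h => hpp h)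
    exact Finset.sum_pos' (fun i _ => sq_nonneg _)
      ⟨i, Finset.mem_univ i, by have := sub_ne_zero.2 hi; positivity⟩
  have hexp : N q'.toAdd = N q.toAdd + 2 * (∑ i, p.toAdd i * q.toAdd i
      - ∑ i, p'.toAdd i * q.toAdd i) + ∑ i, (p.toAdd i - p'.toAdd i) ^ 2 := by
    simp only [N, hq', ← Finset.sum_sub_distrib, Finset.mul_sum, ← Finset.sum_add_distrib]
    exact Finset.sum_congr rfl fun i _ => by ring
  have := hmax p' hp'
  have := hN q.toAdd
  omega

theorem isPeelable_of_commGroup {A : Type*} [CommGroup A]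
    (hA : ∀ (a : A) (k : ℕ), 1 ≤ k → a ^ k = 1 → a = 1) (P : Finset A) (hP : P.Nonempty) :
    IsPeelable P := by
  classical
  let B : Subgroup A := Subgroup.closure P
  have hfree : ∀ T : Finset B, T.Nonempty → IsPeelable T := by
    intro T hT
    have : Group.FG B := (Group.fg_iff_subgroup_fg B).2 ⟨P, rfl⟩
    have : Module.Finite ℤ (Additive B) :=
      Module.Finite.iff_addGroup_fg.2 inferInstance
    have : IsMulTorsionFree B := isMulTorsionFree_iff_not_isOfFinOrder.2 fun b hb hfin => by
      obtain ⟨k, hk, hbk⟩ := isOfFinOrder_iff_pow_eq_one.1 hfin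
      exact hb (Subtype.ext (hA b k hk (by exact_mod_cast congrArg Subtype.val hbk)))
    have : Module.IsTorsionFree ℤ (Additive B) := inferInstance
    have : Module.Free ℤ (Additive B) := inferInstance
    let b := Module.finBasis ℤ (Additive B)
    let f : B →* Multiplicative (Fin (Module.finrank ℤ (Additive B)) → ℤ) :=
      AddMonoidHom.toMultiplicativeRight b.equivFun.toAddEquiv.toAddMonoidHom
    exact IsPeelable.of_injective f (fun x y h => b.equivFun.injective h)
      (isPeelable_lattice _ (hT.image _))
  refine IsPeelable.of_hom (QuotientGroup.mk' B) (IsPeelable.of_subsingleton (hP.image _) ?_) ?_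
  · have h1 : ∀ x ∈ P.image (QuotientGroup.mk' B), x = 1 := by
      intro x hx
      obtain ⟨p, hp, rfl⟩ := Finset.mem_image.1 hx
      exact (QuotientGroup.eq_one_iff p).2 (Subgroup.subset_closure hp)
    exact fun x hx y hy => (h1 x hx).trans (h1 y hy).symm
  · rw [QuotientGroup.ker_mk']
    exact hfree

theorem isPeelable_quotient_ratDerived {G : Type*} [Group G] (i : ℕ)
    (P : Finset (G ⧸ ratDerived G i)) (hP : P.Nonempty) : IsPeelable P := by
  classical
  induction i with
  | zero =>
    have : Subsingleton (G ⧸ ratDerived G 0) := QuotientGroup.subsingleton_quotient_top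
    exact IsPeelable.of_subsingleton hP fun _ _ _ _ => Subsingleton.elim _ _
  | succ i ih =>
    let φ : G ⧸ ratDerived G (i + 1) →* G ⧸ ratDerived G i :=
      QuotientGroup.map _ _ (MonoidHom.id G) (ratDerived_antitone (Nat.le_succ i))
    have hφ : ∀ x ∈ φ.ker, ∃ g ∈ ratDerived G i, (g : G ⧸ ratDerived G (i + 1)) = x := by
      intro x hx
      obtain ⟨g, rfl⟩ := QuotientGroup.mk_surjective x
      exact ⟨g, (QuotientGroup.eq_one_iff g).1 hx, rfl⟩
    refine IsPeelable.of_hom φ (ih _ (hP.image _)) fun T hT => ?_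
    let _ : CommGroup φ.ker := { (inferInstance : Group φ.ker) with
      mul_comm := by
        rintro ⟨x, hx⟩ ⟨y, hy⟩
        obtain ⟨g, hg, rfl⟩ := hφ x hx
        obtain ⟨h, hh, rfl⟩ := hφ y hy
        apply Subtype.ext
        change ((g * h : G) : G ⧸ ratDerived G (i + 1)) = ((h * g : G) : G ⧸ _)
        rw [QuotientGroup.eq]
        refine commutator_le_ratDerived_succ i ?_
        have := Subgroup.commutator_mem_commutator (inv_mem hh) (inv_mem hg)
        simpa [commutatorElement_def, mul_assoc] using this }
    refine isPeelable_of_commGroup ?_ T hT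
    rintro ⟨x, hx⟩ k hk hxk
    obtain ⟨g, hg, rfl⟩ := hφ x hx
    have hgk : ((g ^ k : G) : G ⧸ ratDerived G (i + 1)) = 1 := congrArg Subtype.val hxk
    exact Subtype.ext ((QuotientGroup.eq_one_iff g).2
      (mem_ratDerived_succ_of_pow hg hk ((QuotientGroup.eq_one_iff _).1 hgk)))

end Peeling

section Labelling

/-- The product of the first `l` letters of the infinite positive word `s`. -/
def prefixWord {S : Type*} (s : ℕ → S) : ℕ → FreeGroup S
  | 0 => 1
  | l + 1 => prefixWord s l * FreeGroup.of (s l)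

/-- A labelling of the edges of the Schreier graph of an action on `A` by elements of `X` (an edge
being given by its letter and its target), as a homomorphism to a wreath product. -/
def labelHom {S G A X : Type*} [Group G] [MulAction G A] [Group X] (γ : FreeGroup S →* G)
    (f : S → A → X) : FreeGroup S →* (A → X) ⋊[mulAutArrow] G :=
  FreeGroup.lift fun e => ⟨f e, γ (FreeGroup.of e)⟩

section

variable {S G A X : Type*} [Group G] [MulAction G A] [Group X] (γ : FreeGroup S →* G)
  (f : S → A → X)

theorem labelHom_of (e : S) : labelHom γ f (FreeGroup.of e) = ⟨f e, γ (FreeGroup.of e)⟩ :=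
  FreeGroup.lift_apply_of

theorem labelHom_right (u : FreeGroup S) : (labelHom γ f u).right = γ u := by
  have : SemidirectProduct.rightHom.comp (labelHom γ f) = γ := by
    refine FreeGroup.ext_hom _ _ fun e => ?_
    rw [MonoidHom.comp_apply, labelHom_of]
    rfl
  exact DFunLike.congr_fun this u

theorem left_mul_apply (x y : (A → X) ⋊[mulAutArrow] G) (a : A) :
    (x * y).left a = x.left a * y.left (x.right⁻¹ • a) :=
  rfl

theorem labelHom_prefixWord_left (s : ℕ → S) (l : ℕ) (a : A) :
    (labelHom γ f (prefixWord s l)).left a =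
      ((List.range l).map fun i => f (s i) ((γ (prefixWord s i))⁻¹ • a)).prod := by
  induction l with
  | zero => simp [prefixWord]
  | succ l ih =>
    rw [prefixWord, map_mul, left_mul_apply, ih, labelHom_right, labelHom_of, List.range_succ]
    simp

end

theorem WellFounded.existsUnique_fixedPoint {Q X : Type*} [Nonempty X] {r : Q → Q → Prop}
    (hr : WellFounded r) (Φ : Q → (Q → X) → X)
    (hΦ : ∀ q h h', (∀ p, r p q → h p = h' p) → Φ q h = Φ q h') :
    ∃! h : Q → X, ∀ q, h q = Φ q h := by
  classical
  let x₀ : X := Classical.arbitrary X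
  let h : Q → X := hr.fix fun q ih => Φ q fun p => if hp : r p q then ih p hp else x₀
  refine ⟨h, fun q => ?_, fun h' hh' => ?_⟩
  · refine (hr.fix_eq _ q).trans (hΦ q _ _ fun p hp => ?_)
    rw [dif_pos hp]
  · funext q
    induction q using hr.induction with
    | _ q ih =>
      rw [hh' q]
      refine Eq.trans ?_ (hr.fix_eq (fun q ih => Φ q fun p => if hp : r p q then ih p hp else x₀)
        q).symm
      refine hΦ q _ _ fun p hp => ?_
      rw [dif_pos hp]
      exact ih p hp

/-- If every relation contains an edge that occurs in it exactly once and in no earlier relation,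
then these edges can be eliminated. -/
theorem existsUnique_labelling {E Q X : Type*} [Group X] {n : ℕ} (edge : ℕ → Q → E) (κ : Q → ℕ)
    (hκ : ∀ q, κ q < n) {r : Q → Q → Prop} (hr : WellFounded r)
    (h : ∀ q q' i, i < n → edge i q = edge (κ q') q' → (i = κ q ∧ q' = q) ∨ r q' q) (g : E → X) :
    ∃! f : E → X, (∀ e, e ∉ Set.range (fun q => edge (κ q) q) → f e = g e) ∧
      ∀ q, ((List.range n).map fun i => f (edge i q)).prod = 1 := by
  classical
  let ε : Q → E := fun q => edge (κ q) q
  have hε : Function.Injective ε := by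
    intro q q' hqq
    rcases h q q' _ (hκ q) hqq with h1 | h1
    · exact h1.2.symm
    rcases h q' q _ (hκ q') hqq.symm with h2 | h2
    · exact h2.2
    exact absurd h2 (hr.asymmetric _ _ h1)
  let ext : (Q → X) → E → X := fun k e => if he : ∃ q, ε q = e then k he.choose else g e
  have ext_ε : ∀ k q, ext k (ε q) = k q := by
    intro k q
    have he : ∃ q', ε q' = ε q := ⟨q, rfl⟩
    simp only [ext, dif_pos he]
    exact congrArg k (hε he.choose_spec)
  have ext_not : ∀ k e, e ∉ Set.range ε → ext k e = g e := fun k e he => dif_neg he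
  let L : (E → X) → Q → X := fun f q => ((List.range (κ q)).map fun i => f (edge i q)).prod
  let R : (E → X) → Q → X := fun f q =>
    ((List.range (n - κ q - 1)).map fun i => f (edge (κ q + 1 + i) q)).prod
  have hprod : ∀ (f : E → X) q,
      ((List.range n).map fun i => f (edge i q)).prod = L f q * f (ε q) * R f q := by
    intro f q
    have hn : n = κ q + 1 + (n - κ q - 1) := by have := hκ q; omega
    conv_lhs => rw [hn, List.range_add, List.range_succ]
    simp [L, R, ε, mul_assoc, Function.comp_def]
  have hsolve : ∀ (f : E → X) q, ((List.range n).map fun i => f (edge i q)).prod = 1 ↔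
      f (ε q) = (L f q)⁻¹ * (R f q)⁻¹ := by
    intro f q
    rw [hprod, mul_eq_one_iff_eq_inv, eq_inv_mul_iff_mul_eq]
  have hagree : ∀ k k' q, (∀ p, r p q → k p = k' p) → ∀ i, i < n → i ≠ κ q →
      ext k (edge i q) = ext k' (edge i q) := by
    intro k k' q hkk i hi hiκ
    by_cases he : ∃ q', ε q' = edge i q
    · obtain ⟨q', hq'⟩ := he
      rw [← hq', ext_ε, ext_ε]
      rcases h q q' i hi hq'.symm with h1 | h1
      · exact absurd h1.1 hiκ
      · exact hkk q' h1
    · rw [ext_not k _ he, ext_not k' _ he]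
  obtain ⟨k, hk, huniq⟩ := hr.existsUnique_fixedPoint
    (fun q k => (L (ext k) q)⁻¹ * (R (ext k) q)⁻¹) (by
      intro q k k' hkk
      have hL : L (ext k) q = L (ext k') q := by
        refine congrArg List.prod (List.map_congr_left fun i hi => ?_)
        have := List.mem_range.1 hi
        have := hκ q
        exact hagree k k' q hkk i (by omega) (by omega)
      have hR : R (ext k) q = R (ext k') q := by
        refine congrArg List.prod (List.map_congr_left fun i hi => ?_)
        have := List.mem_range.1 hi
        have := hκ q
        exact hagree k k' q hkk _ (by omega) (by omega)
      simp only [hL, hR])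
  refine ⟨ext k, ⟨fun e he => ext_not k e he, fun q => (hsolve _ q).2 ?_⟩, ?_⟩
  · rw [ext_ε]
    exact hk q
  · rintro f ⟨hfg, hf⟩
    have hext : f = ext (f ∘ ε) := by
      funext e
      by_cases he : ∃ q, ε q = e
      · obtain ⟨q, rfl⟩ := he
        rw [ext_ε]
        rfl
      · rw [ext_not _ _ he, hfg e he]
    have : f ∘ ε = k := huniq _ fun q => by
      rw [← hext]
      exact (hsolve f q).1 (hf q)
    rw [hext, this]

end Labelling

section Freeness

open CategoryTheory

universe u

theorem isFreeGroup_of_isFreeGroupoid {G : Type u} [Group G] (N : Subgroup G)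
    [IsFreeGroupoid (ActionCategory G (G ⧸ N))] : IsFreeGroup N := by
  let x₀ : ActionCategory G (G ⧸ N) := ActionCategory.objEquiv G (G ⧸ N) ((1 : G) : G ⧸ N)
  let inst : Groupoid (ActionCategory G (G ⧸ N)) := inferInstance
  have hconn : @IsConnected _ inst.toCategory :=
    (inferInstance : IsConnected (ActionCategory G (G ⧸ N)))
  have hfree : @IsFreeGroup (@End _ inst.toCategory.toCategoryStruct x₀) _ :=
    @IsFreeGroupoid.endIsFreeOfConnectedFree _ inst hconn _ x₀
  let e : (@End _ inst.toCategory.toCategoryStruct x₀) ≃* N :=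
    { (ActionCategory.endMulEquivSubgroup N).toEquiv with
      map_mul' := (ActionCategory.endMulEquivSubgroup N).map_mul' }
  exact IsFreeGroup.ofMulEquiv e

theorem isFreeGroup_of_isPeelable {S : Type u} (s : ℕ → S) {n : ℕ} (hn : 0 < n)
    {w : FreeGroup S} (hw : w = prefixWord s n)
    (N : Subgroup (FreeGroup S ⧸ Subgroup.normalClosure {w})) [N.Normal]
    (hinj : ∀ a < n, ∀ b < n,
      (((prefixWord s a : FreeGroup S ⧸ Subgroup.normalClosure {w}) : _ ⧸ N)) =
        ((prefixWord s b : FreeGroup S ⧸ Subgroup.normalClosure {w}) : _ ⧸ N) → a = b)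
    (hpeel : ∀ P : Finset ((FreeGroup S ⧸ Subgroup.normalClosure {w}) ⧸ N), P.Nonempty →
      IsPeelable P) : IsFreeGroup N := by
  classical
  let G := FreeGroup S ⧸ Subgroup.normalClosure {w}
  let Q := G ⧸ N
  let γ : FreeGroup S →* G := QuotientGroup.mk' _
  let pt : ℕ → Q := fun i => ((γ (prefixWord s i) : G) : Q)⁻¹
  let edge : ℕ → Q → S × Q := fun i q => (s i, pt i * q)
  let I : Finset ℕ := (Finset.range n).filter fun i => s i = s 0
  obtain ⟨r, hr, hpeel⟩ := hpeel (I.image pt)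
    ((show I.Nonempty from ⟨0, Finset.mem_filter.2 ⟨Finset.mem_range.2 hn, rfl⟩⟩).image pt)
  have hκ : ∀ q, ∃ i, i < n ∧ s i = s 0 ∧
      ∀ j < n, s j = s 0 → ∀ q', pt i * q = pt j * q' → q' = q ∨ r q q' := by
    intro q
    obtain ⟨p, hp, h⟩ := hpeel q
    obtain ⟨i, hi, rfl⟩ := Finset.mem_image.1 hp
    obtain ⟨hin, his⟩ := Finset.mem_filter.1 hi
    refine ⟨i, Finset.mem_range.1 hin, his, fun j hj hjs q' hq => h _ ?_ q' hq⟩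
    exact Finset.mem_image_of_mem pt (Finset.mem_filter.2 ⟨Finset.mem_range.2 hj, hjs⟩)
  choose κ hκn hκs hκr using hκ
  let E : Set (S × Q) := Set.range fun q => edge (κ q) q
  have key : ∀ {X : Type u} [Group X] (g : S × Q → X),
      ∃! f : S × Q → X, (∀ e, e ∉ E → f e = g e) ∧
        ∀ q, ((List.range n).map fun i => f (edge i q)).prod = 1 := by
    intro X _ g
    refine existsUnique_labelling edge κ hκn hr ?_ g
    intro q q' i hi hedge
    obtain ⟨h1, h2⟩ := Prod.mk.inj hedge
    rcases hκr q' i hi (h1.trans (hκs q')) q h2.symm with rfl | h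
    · refine Or.inl ⟨hinj i hi _ (hκn q) ?_, rfl⟩
      exact inv_injective (mul_right_cancel h2)
    · exact Or.inr h
  have hrel : ∀ {X : Type u} [Group X] (f : S → Q → X) (q : Q),
      (labelHom γ f w).left q = ((List.range n).map fun i => f (s i) (pt i * q)).prod := by
    intro X _ f q
    exact (congrArg (fun u => (labelHom γ f u).left q) hw).trans
      (labelHom_prefixWord_left γ f s n q)
  let _ : IsFreeGroupoid (ActionCategory G Q) :=
    { quiverGenerators :=
        ⟨fun a b => { e : S // γ (FreeGroup.of e) • a.back = b.back ∧ (e, b.back) ∉ E }⟩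
      of := fun e => ⟨γ (FreeGroup.of e.1), e.2.1⟩
      unique_lift := by
        intro X _ f
        let g : S × Q → X := fun e =>
          if he : e ∉ E then
            @f ⟨(), (γ (FreeGroup.of e.1))⁻¹ • e.2⟩ ⟨(), e.2⟩ ⟨e.1, smul_inv_smul _ _, he⟩
          else 1
        obtain ⟨k, ⟨hkg, hk⟩, huniq⟩ := key g
        let Λ := labelHom γ fun e q => k (e, q)
        have hΛw : Λ w = 1 := by
          refine SemidirectProduct.ext (funext fun q => ?_) ?_
          · exact (hrel _ q).trans (hk q)
          · exact (labelHom_right _ _ _).trans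
              ((QuotientGroup.eq_one_iff w).2 (Subgroup.subset_normalClosure rfl))
        let F' : G →* (Q → X) ⋊[mulAutArrow] G := QuotientGroup.lift _ Λ
          (Subgroup.normalClosure_le_normal (Set.singleton_subset_iff.2 hΛw))
        refine ⟨ActionCategory.uncurry F' ?_, ?_, ?_⟩
        · intro x
          obtain ⟨u, rfl⟩ := QuotientGroup.mk_surjective x
          exact labelHom_right _ _ u
        · rintro ⟨⟨⟩, a : Q⟩ ⟨⟨⟩, b : Q⟩ ⟨e, h : γ (FreeGroup.of e) • a = b, he⟩
          change (Λ (FreeGroup.of e)).left b = _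
          change (e, b) ∉ E at he
          cases inv_smul_eq_iff.mpr h.symm
          rw [labelHom_of]
          change k (e, b) = _
          rw [hkg _ he]
          exact dif_pos he
        · intro Ψ hΨ
          let k' : S × Q → X := fun e =>
            (ActionCategory.curry Ψ (γ (FreeGroup.of e.1))).left e.2
          have hcurry : (ActionCategory.curry Ψ).comp γ = labelHom γ fun e q => k' (e, q) := by
            refine FreeGroup.ext_hom _ _ fun e => ?_
            rw [labelHom_of]
            rfl
          have hk' : k' = k := by
            refine huniq k' ⟨?_, fun q => ?_⟩
            · rintro ⟨e, b⟩ he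
              refine Eq.trans ?_ (dif_pos he).symm
              exact hΨ ⟨(), (γ (FreeGroup.of e))⁻¹ • b⟩ ⟨(), b⟩ ⟨e, smul_inv_smul _ _, he⟩
            · refine (hrel (fun e q => k' (e, q)) q).symm.trans ?_
              rw [← hcurry, MonoidHom.comp_apply,
                show γ w = 1 from
                  (QuotientGroup.eq_one_iff w).2 (Subgroup.subset_normalClosure rfl), map_one]
              rfl
          have hF' : ActionCategory.curry Ψ = F' := by
            refine QuotientGroup.monoidHom_ext _ ?_
            refine hcurry.trans ?_
            rw [hk']
            rfl
          apply Functor.hext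
          · intro
            apply Unit.ext
          · refine ActionCategory.cases ?_
            intro t g
            exact heq_of_eq
              (congrFun (congrArg SemidirectProduct.left (DFunLike.congr_fun hF' g)) t) }
  exact isFreeGroup_of_isFreeGroupoid N

end Freeness

section FoxCalculus

theorem left_eq_one_of_mem_ratDerived_succ {G X : Type*} [Group G] [CommGroup X] (i : ℕ)
    (hX : ∀ x : X, ∀ k : ℕ, 1 ≤ k → x ^ k = 1 → x = 1)
    (Λ : G →* ((G ⧸ ratDerived G i) → X) ⋊[mulAutArrow] G) (hΛ : ∀ g, (Λ g).right = g)
    {g : G} (hg : g ∈ ratDerived G (i + 1)) (q : G ⧸ ratDerived G i) : (Λ g).left q = 1 := by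
  have hsmul : ∀ u ∈ ratDerived G i, ∀ q : G ⧸ ratDerived G i, u • q = q := by
    intro u hu q
    obtain ⟨x, rfl⟩ := QuotientGroup.mk_surjective q
    refine QuotientGroup.eq.2 ?_
    have := (ratDerived_normal G i).conj_mem _ (inv_mem hu) x⁻¹
    simpa [mul_assoc] using this
  let φ : ratDerived G i →* X :=
    { toFun := fun u => (Λ u).left q
      map_one' := by simp
      map_mul' := fun u v => by
        rw [Subgroup.coe_mul, map_mul, left_mul_apply, hΛ, hsmul _ (inv_mem u.2)] }
  obtain ⟨u, hu, rfl⟩ := ratDerived_succ_le_map_ker hX φ hg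
  exact hu

/-- The Fox derivative of the path spelling the first `l` letters of `s`, where `pt t * q` is the
target of its `t`-th edge. -/
noncomputable def pathChain {S Q : Type*} [Group Q] (s : ℕ → S) (pt : ℕ → Q) (l : ℕ) (q : Q) :
    S × Q →₀ ℚ :=
  ∑ t ∈ Finset.range l, Finsupp.single (s t, pt t * q) 1

theorem pathChain_apply_ne_zero_iff {S Q : Type*} [Group Q] {s : ℕ → S} {pt : ℕ → Q} {l : ℕ} {q : Q}
    {e : S × Q} : pathChain s pt l q e ≠ 0 ↔ ∃ t < l, (s t, pt t * q) = e := by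
  classical
  rw [pathChain, Finsupp.finsetSum_apply, Ne, Finset.sum_eq_zero_iff_of_nonneg]
  · simp [Finsupp.single_apply]
  · intro t _
    rw [Finsupp.single_apply]
    split_ifs <;> norm_num

theorem sum_single_mem_span_of_mem_ratDerived {S : Type*} (s : ℕ → S) {n : ℕ} {w : FreeGroup S}
    (hw : w = prefixWord s n) (i : ℕ)
    (pt : ℕ → (FreeGroup S ⧸ Subgroup.normalClosure {w}) ⧸ ratDerived _ i)
    (hpt : ∀ l, pt l = ((prefixWord s l : FreeGroup S ⧸ Subgroup.normalClosure {w}) : _ ⧸ _)⁻¹)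
    {j k : ℕ} (hjk : j ≤ k)
    (hmem : (prefixWord s k : FreeGroup S ⧸ Subgroup.normalClosure {w}) *
      (prefixWord s j : FreeGroup S ⧸ Subgroup.normalClosure {w})⁻¹ ∈ ratDerived _ (i + 1)) :
    ∑ l ∈ Finset.Ico j k, Finsupp.single (s l, pt l) 1 ∈
      Submodule.span ℚ (Set.range (pathChain s pt n)) := by
  let G := FreeGroup S ⧸ Subgroup.normalClosure {w}
  let Q := G ⧸ ratDerived G i
  let γ : FreeGroup S →* G := QuotientGroup.mk' _
  let W : Submodule ℚ (S × Q →₀ ℚ) := Submodule.span ℚ (Set.range (pathChain s pt n))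
  let X := Multiplicative ((S × Q →₀ ℚ) ⧸ W)
  let f : S → Q → X := fun e q => Multiplicative.ofAdd (W.mkQ (Finsupp.single (e, q) 1))
  have hvalue : ∀ l q, (labelHom γ f (prefixWord s l)).left q =
      Multiplicative.ofAdd (W.mkQ (pathChain s pt l q)) := by
    intro l q
    have hedge : ∀ t, f (s t) ((γ (prefixWord s t))⁻¹ • q) =
        Multiplicative.ofAdd (W.mkQ (Finsupp.single (s t, pt t * q) 1)) := by
      intro t
      rw [hpt]
      rfl
    rw [labelHom_prefixWord_left]
    simp only [hedge]
    induction l with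
    | zero => simp [pathChain]
    | succ l ih =>
      rw [List.range_succ, List.map_append, List.prod_append, ih, pathChain, pathChain,
        Finset.sum_range_succ, map_add, ofAdd_add]
      simp
  have hΛw : labelHom γ f w = 1 := by
    refine SemidirectProduct.ext (funext fun q => ?_) ?_
    · refine (congrArg (fun u => (labelHom γ f u).left q) hw).trans ((hvalue n q).trans ?_)
      refine ofAdd_eq_one.2 ((Submodule.Quotient.mk_eq_zero W).2 ?_)
      exact Submodule.subset_span ⟨q, rfl⟩
    · exact (labelHom_right _ _ _).trans
        ((QuotientGroup.eq_one_iff w).2 (Subgroup.subset_normalClosure rfl))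
  let Λ : G →* (Q → X) ⋊[mulAutArrow] G := QuotientGroup.lift _ (labelHom γ f)
    (Subgroup.normalClosure_le_normal (Set.singleton_subset_iff.2 hΛw))
  have hΛ : ∀ g, (Λ g).right = g := by
    intro g
    obtain ⟨u, rfl⟩ := QuotientGroup.mk_surjective g
    exact labelHom_right _ _ u
  let u : G := γ (prefixWord s k) * (γ (prefixWord s j))⁻¹
  have hu : (Λ u).left 1 = 1 := by
    refine left_eq_one_of_mem_ratDerived_succ i ?_ Λ hΛ hmem 1
    intro x m hm hx
    have h : (m : ℚ) • x.toAdd = 0 := by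
      rw [Nat.cast_smul_eq_nsmul, ← toAdd_pow, hx]
      rfl
    exact toAdd_eq_zero.1 ((smul_eq_zero.1 h).resolve_left (by positivity))
  have hone : u⁻¹ • (1 : Q) = 1 := by
    refine (mul_one ((u⁻¹ : G) : Q)).trans ((QuotientGroup.eq_one_iff _).2 ?_)
    exact inv_mem (ratDerived_antitone (Nat.le_succ i) hmem)
  have h : (Λ (γ (prefixWord s k))).left 1 = (Λ (γ (prefixWord s j))).left 1 := by
    have hk : γ (prefixWord s k) = u * γ (prefixWord s j) := (inv_mul_cancel_right _ _).symm
    rw [hk, map_mul, left_mul_apply, hu, one_mul, hΛ, hone]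
  replace h : W.mkQ (pathChain s pt k 1) = W.mkQ (pathChain s pt j 1) :=
    Multiplicative.ofAdd.injective ((hvalue k 1).symm.trans (h.trans (hvalue j 1)))
  have hsub := (Submodule.Quotient.eq W).1 h
  rw [pathChain, pathChain, ← Finset.sum_Ico_eq_sub _ hjk] at hsub
  simpa only [mul_one] using hsub

theorem exists_eq_smul_pathChain {S Q : Type*} [Group Q] (s : ℕ → S) (pt : ℕ → Q) {n : ℕ}
    (hpeel : ∀ P : Finset Q, P.Nonempty → IsPeelable P) (hn : 0 < n) {v : S × Q →₀ ℚ}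
    (hv : v ∈ Submodule.span ℚ (Set.range (pathChain s pt n)))
    (hsupp : ∀ e, v e ≠ 0 → ∃ t < n, (s t, pt t) = e) :
    ∃ c : ℚ, v = c • pathChain s pt n 1 := by
  classical
  let I : Finset ℕ := (Finset.range n).filter fun t => s t = s 0
  obtain ⟨r, hr, hpeel⟩ := hpeel (I.image pt)
    ((show I.Nonempty from ⟨0, Finset.mem_filter.2 ⟨Finset.mem_range.2 hn, rfl⟩⟩).image pt)
  obtain ⟨m, -, hm⟩ := hr.has_min Set.univ ⟨1, trivial⟩
  have hI : ∀ t < n, s t = s 0 → pt t ∈ I.image pt := fun t ht hst =>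
    Finset.mem_image_of_mem pt (Finset.mem_filter.2 ⟨Finset.mem_range.2 ht, hst⟩)
  obtain ⟨α, rfl⟩ := (Finsupp.mem_span_range_iff_exists_finsupp).1 hv
  suffices hα : ∀ q ∈ α.support, q = 1 by
    refine ⟨α 1, Finsupp.sum_of_support_subset α (s := {1}) ?_ _ ?_ |>.trans ?_⟩
    · exact fun q hq => Finset.mem_singleton.2 (hα q hq)
    · simp
    · simp
  by_contra! hne
  have : IsWellFounded Q r := ⟨hr⟩
  obtain ⟨q₀, hq₀, hq₀1⟩ := hne
  obtain ⟨a, ha, hmax⟩ := Finset.exists_max_image (α.support.erase 1)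
    (fun q => IsWellFounded.rank r (q * m)) ⟨q₀, Finset.mem_erase.2 ⟨hq₀1, hq₀⟩⟩
  obtain ⟨ha1, haα⟩ := Finset.mem_erase.1 ha
  obtain ⟨p, hp, hpa⟩ := hpeel (a * m)
  obtain ⟨t₀, ht₀, rfl⟩ := Finset.mem_image.1 hp
  obtain ⟨ht₀n, hst₀⟩ := Finset.mem_filter.1 ht₀
  have hmeet : ∀ q, pathChain s pt n q (s 0, pt t₀ * a) ≠ 0 → q = a ∨ r (a * m) (q * m) := by
    intro q hq
    obtain ⟨t, ht, hst⟩ := pathChain_apply_ne_zero_iff.1 hq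
    obtain ⟨h1, h2⟩ := Prod.mk.inj hst
    have := hpa _ (hI t ht h1) (q * m) (by rw [← mul_assoc, ← h2, mul_assoc])
    exact this.imp mul_right_cancel id
  have hnot : ¬ r (a * m) (1 * m) := by
    rw [one_mul]
    exact hm _ trivial
  have hcoeff : (α.sum fun q x => x • pathChain s pt n q) (s 0, pt t₀ * a) =
      α a * pathChain s pt n a (s 0, pt t₀ * a) := by
    rw [Finsupp.sum_apply, Finsupp.sum, Finset.sum_eq_single a]
    · rfl
    · intro q hq hqa
      by_contra h
      have h' : pathChain s pt n q (s 0, pt t₀ * a) ≠ 0 := fun h0 => h (by simp [h0])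
      have hrq := (hmeet q h').resolve_left hqa
      rcases eq_or_ne q 1 with rfl | hq1
      · exact hnot hrq
      · exact (IsWellFounded.rank_lt_of_rel hrq).not_ge (hmax q (Finset.mem_erase.2 ⟨hq1, hq⟩))
    · exact fun h => absurd haα h
  have hne : (α.sum fun q x => x • pathChain s pt n q) (s 0, pt t₀ * a) ≠ 0 := by
    rw [hcoeff]
    refine mul_ne_zero (Finsupp.mem_support_iff.1 haα) ?_
    exact pathChain_apply_ne_zero_iff.2 ⟨t₀, Finset.mem_range.1 ht₀n, by rw [hst₀]⟩
  obtain ⟨t, ht, hst⟩ := hsupp _ hne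
  have := hmeet 1 (pathChain_apply_ne_zero_iff.2 ⟨t, ht, by rw [mul_one]; exact hst⟩)
  exact this.elim (fun h => ha1 h.symm) hnot

end FoxCalculus

section Periodicity

theorem prefixWord_mul_of_periodic {S : Type*} {s : ℕ → S} {d n : ℕ}
    (hs : ∀ l, l + d < n → s (l + d) = s l) (m : ℕ) (hm : d * m ≤ n) :
    prefixWord s (d * m) = prefixWord s d ^ m := by
  have hmod : ∀ q r, d * q + r < n → s (d * q + r) = s r := by
    intro q r
    induction q with
    | zero => simp
    | succ q ih =>
      intro h
      have hq : d * (q + 1) + r = d * q + r + d := by ring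
      rw [hq] at h ⊢
      rw [hs _ h, ih (by omega)]
  have hadd : ∀ q r, d * q + r ≤ n →
      prefixWord s (d * q + r) = prefixWord s (d * q) * prefixWord s r := by
    intro q r
    induction r with
    | zero => simp [prefixWord]
    | succ r ih =>
      intro h
      rw [← add_assoc, prefixWord, prefixWord, ih (by omega), hmod q r (by omega), mul_assoc]
  induction m with
  | zero => simp [prefixWord]
  | succ m ih =>
    rw [mul_add, mul_one] at hm ⊢
    rw [hadd m d hm, ih (by omega), pow_succ]

/-- If a closed path spelling `s` runs through the edges of a simple closed subpath only, then it
is a proper power. -/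
theorem exists_prefixWord_eq_pow {S Q : Type*} {s : ℕ → S} {pt : ℕ → Q} (T : S → Q → Q)
    (hT : ∀ l, pt (l + 1) = T (s l) (pt l)) {n j k : ℕ} (hjk : j < k) (hkn : k ≤ n)
    (hlt : k - j < n) (hinj : Set.InjOn pt (Set.Ico j k)) (hloop : pt j = pt k)
    (hclosed : pt n = pt 0)
    (hcov : ∀ l < n, ∃ t ∈ Set.Ico j k, (s t, pt t) = (s l, pt l)) :
    ∃ d m, 0 < d ∧ d < n ∧ 1 ≤ m ∧ prefixWord s n = prefixWord s d ^ m := by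
  classical
  let σ : Q → S := fun q => if h : ∃ t ∈ Set.Ico j k, pt t = q then s h.choose else s 0
  have hσ : ∀ l < n, σ (pt l) = s l := by
    intro l hl
    obtain ⟨t, ht, hst⟩ := hcov l hl
    obtain ⟨h1, h2⟩ := Prod.mk.inj hst
    have h : ∃ t ∈ Set.Ico j k, pt t = pt l := ⟨t, ht, h2⟩
    have hc : h.choose = t := hinj h.choose_spec.1 ht (h.choose_spec.2.trans h2.symm)
    simp only [σ, dif_pos h]
    rw [hc, h1]
  let next : Q → Q := fun q => T (σ q) q
  have hnext : ∀ a r, a + r ≤ n → next^[r] (pt a) = pt (a + r) := by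
    intro a r
    induction r with
    | zero => simp
    | succ r ih =>
      intro h
      rw [Function.iterate_succ_apply', ih (by omega), ← add_assoc, hT]
      simp only [next]
      rw [hσ _ (by omega)]
  have hn : Function.IsPeriodicPt next n (pt 0) := by
    have := hnext 0 n (by omega)
    rw [zero_add, hclosed] at this
    exact this
  have hm : Function.IsPeriodicPt next (k - j) (pt 0) := by
    have hj : Function.IsPeriodicPt next (k - j) (pt j) := by
      have := hnext j (k - j) (by omega)
      rw [Nat.add_sub_cancel' hjk.le, ← hloop] at this
      exact this
    obtain ⟨t, ⟨htj, htk⟩, ht⟩ := hcov 0 (by omega)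
    have h := hnext j (t - j) (by omega)
    rw [Nat.add_sub_cancel' htj, (Prod.mk.inj ht).2] at h
    rw [← h]
    exact hj.apply_iterate _
  have hd := hn.gcd hm
  have hd0 : 0 < n.gcd (k - j) := Nat.gcd_pos_of_pos_right _ (by omega)
  have hdle : n.gcd (k - j) ≤ k - j := Nat.gcd_le_right _ (by omega)
  obtain ⟨m, hnm⟩ := Nat.gcd_dvd_left n (k - j)
  refine ⟨n.gcd (k - j), m, hd0, by omega, ?_, ?_⟩
  · rcases Nat.eq_zero_or_pos m with rfl | h
    · omega
    · exact h
  · conv_lhs => rw [hnm]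
    refine prefixWord_mul_of_periodic (n := n) (fun l hl => ?_) m hnm.ge
    have h1 := hnext 0 (l + n.gcd (k - j)) (by omega)
    have h2 := hnext 0 l (by omega)
    rw [Function.iterate_add_apply, hd.eq, h2, zero_add, zero_add] at h1
    rw [← hσ _ hl, ← h1, hσ l (by omega)]

theorem prefixWord_ne_pow {S : Type*} {s : ℕ → S} {n : ℕ} {w : FreeGroup S}
    (hw : w = prefixWord s n)
    (htf : ∀ g : FreeGroup S ⧸ Subgroup.normalClosure {w}, IsOfFinOrder g → g = 1)
    {d m : ℕ} (hd : 0 < d) (hdn : d < n) (hm : 1 ≤ m) : prefixWord s n ≠ prefixWord s d ^ m := by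
  intro hpow
  have hmem : prefixWord s d ∈ Subgroup.normalClosure {w} := by
    refine (QuotientGroup.eq_one_iff _).1 (htf _ (isOfFinOrder_iff_pow_eq_one.2 ⟨m, hm, ?_⟩))
    rw [← QuotientGroup.mk_pow, ← hpow, ← hw]
    exact (QuotientGroup.eq_one_iff _).2 (Subgroup.subset_normalClosure rfl)
  let ψ : FreeGroup S →* Multiplicative (ZMod n) :=
    FreeGroup.lift fun _ => Multiplicative.ofAdd 1
  have hψ : ∀ l, ψ (prefixWord s l) = Multiplicative.ofAdd (l : ZMod n) := by
    intro l
    induction l with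
    | zero => simp [prefixWord]
    | succ l ih => rw [prefixWord, map_mul, ih, FreeGroup.lift_apply_of, Nat.cast_succ, ofAdd_add]
  have hle : Subgroup.normalClosure {w} ≤ ψ.ker := by
    refine Subgroup.normalClosure_le_normal (Set.singleton_subset_iff.2 ?_)
    refine MonoidHom.mem_ker.2 ?_
    rw [hw, hψ, ZMod.natCast_self, ofAdd_zero]
  have h := MonoidHom.mem_ker.1 (hle hmem)
  rw [hψ, ofAdd_eq_one, ZMod.natCast_eq_zero_iff] at h
  exact absurd (Nat.le_of_dvd hd h) (by omega)

end Periodicity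

section FreeGroups

theorem labelHom_mk_cons {S G A X : Type*} [Group G] [MulAction G A] [Group X]
    (γ : FreeGroup S →* G) (f : S → A → X) (e : S) (b : Bool) (K : List (S × Bool)) (q : A) :
    (labelHom γ f (FreeGroup.mk ((e, b) :: K))).left q =
      (if b then f e q else (f e (γ (FreeGroup.of e) • q))⁻¹) *
        (labelHom γ f (FreeGroup.mk K)).left ((γ (FreeGroup.mk [(e, b)]))⁻¹ • q) := by
  have h : FreeGroup.mk ((e, b) :: K) = FreeGroup.mk [(e, b)] * FreeGroup.mk K := by
    rw [FreeGroup.mul_mk]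
    rfl
  rw [h, map_mul, left_mul_apply, labelHom_right]
  congr 1
  cases b
  · have h' : FreeGroup.mk [(e, false)] = (FreeGroup.of e)⁻¹ := by
      rw [FreeGroup.of, FreeGroup.inv_mk]
      rfl
    rw [h', map_inv, labelHom_of, SemidirectProduct.inv_left]
    change ((f e)⁻¹ : A → X) ((γ (FreeGroup.of e))⁻¹⁻¹ • q) = _
    simp
  · exact congrFun (congrArg SemidirectProduct.left (labelHom_of γ f e)) q

theorem mk_notMem_ratDerived {S : Type*} (i : ℕ) {L : List (S × Bool)}
    (hL : FreeGroup.IsReduced L) (hne : L ≠ []) (hlen : L.length ≤ i) :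
    FreeGroup.mk L ∉ ratDerived (FreeGroup S) i := by
  classical
  induction i generalizing L with
  | zero => exact absurd (List.length_eq_zero_iff.1 (Nat.le_zero.1 hlen)) hne
  | succ i ih =>
    intro hmem
    obtain ⟨⟨e, b⟩, K, rfl⟩ := List.exists_cons_of_ne_nil hne
    let Q := FreeGroup S ⧸ ratDerived (FreeGroup S) i
    let t : FreeGroup S → Q := fun u => (u : Q)⁻¹
    have ht : ∀ u v, t u = t v → u⁻¹ * v ∈ ratDerived (FreeGroup S) i := fun u v h =>
      QuotientGroup.eq.1 (inv_injective h)
    let tgt : List (S × Bool) → S → Bool → Q := fun M a c =>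
      if c then t (FreeGroup.mk M) else t (FreeGroup.mk M * (FreeGroup.of a)⁻¹)
    let f : S → Q → Multiplicative ℤ := fun a q =>
      if a = e ∧ q = tgt [] e b then Multiplicative.ofAdd 1 else 1
    have hsmul : ∀ u v : FreeGroup S, u⁻¹ • t v = t (v * u) := by
      intro u v
      change ((u⁻¹ * v⁻¹ : FreeGroup S) : Q) = ((v * u : FreeGroup S) : Q)⁻¹
      rw [← mul_inv_rev]
      rfl
    have hsnoc : ∀ (M : List (S × Bool)) a c,
        FreeGroup.mk M * FreeGroup.mk [(a, c)] = FreeGroup.mk (M ++ [(a, c)]) := fun M a c =>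
      FreeGroup.mul_mk
    have hinv : ∀ a : S, (FreeGroup.of a)⁻¹ = FreeGroup.mk [(a, false)] := by
      intro a
      rw [FreeGroup.of, FreeGroup.inv_mk]
      rfl
    have hvalue : ∀ (M : List (S × Bool)) a c K',
        (labelHom (MonoidHom.id _) f (FreeGroup.mk ((a, c) :: K'))).left (t (FreeGroup.mk M)) =
          (if c then f a (tgt M a c) else (f a (tgt M a c))⁻¹) *
          (labelHom (MonoidHom.id _) f (FreeGroup.mk K')).left
            (t (FreeGroup.mk (M ++ [(a, c)]))) := by
      intro M a c K'
      rw [labelHom_mk_cons]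
      congr 1
      · cases c
        · have := hsmul (FreeGroup.of a)⁻¹ (FreeGroup.mk M)
          rw [inv_inv] at this
          simp [tgt, this]
        · simp [tgt]
      · rw [← hsnoc, ← hsmul]
        rfl
    have hne_tgt : ∀ (M : List (S × Bool)) a c K', M ≠ [] →
        (e, b) :: K = M ++ (a, c) :: K' → f a (tgt M a c) = 1 := by
      intro M a c K' hM hK
      refine if_neg ?_
      rintro ⟨rfl, htgt⟩
      obtain ⟨x, M', rfl⟩ := List.exists_cons_of_ne_nil hM
      obtain ⟨rfl, hK'⟩ := List.cons.inj hK
      subst hK'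
      have hlen' : M'.length + 1 ≤ i := by simp at hlen; omega
      have hM1 : FreeGroup.mk ((a, b) :: M') ∉ ratDerived (FreeGroup S) i :=
        ih (hL.infix ⟨[], (a, c) :: K', by simp⟩) (by simp) (by simpa using hlen')
      have hM2 : M' ≠ [] → FreeGroup.mk M' ∉ ratDerived (FreeGroup S) i := fun h =>
        ih (hL.infix ⟨[(a, b)], (a, c) :: K', by simp⟩) h (by omega)
      have hM3 : M' = [] → b = c := by
        rintro rfl
        exact (FreeGroup.isReduced_cons_cons.1 hL).1 rfl
      have hcons : ∀ c, FreeGroup.mk ((a, c) :: M') = FreeGroup.mk [(a, c)] * FreeGroup.mk M' :=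
        fun c => (FreeGroup.mul_mk (L₁ := [(a, c)]) (L₂ := M')).symm
      have hnil : (FreeGroup.mk [] : FreeGroup S) = 1 := FreeGroup.one_eq_mk.symm
      have hnormal := ratDerived_normal (FreeGroup S) i
      cases b <;> cases c
      · simp only [tgt, Bool.false_eq_true, if_false] at htgt
        have h := hnormal.conj_mem _ (ht _ _ htgt) (FreeGroup.of a)⁻¹
        rw [hnil] at h
        exact hM1 (inv_mem_iff.1 (by simpa [mul_assoc] using h))
      · simp only [tgt, Bool.false_eq_true, if_false, if_true] at htgt
        have h := ht _ _ htgt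
        rw [hcons, ← hinv, hnil] at h
        exact hM2 (fun h => Bool.noConfusion (hM3 h))
          (inv_mem_iff.1 (by simpa [mul_assoc] using h))
      · simp only [tgt, Bool.false_eq_true, if_false, if_true] at htgt
        have h := hnormal.conj_mem _ (ht _ _ htgt) (FreeGroup.of a)⁻¹
        rw [hcons, hnil, ← FreeGroup.of] at h
        exact hM2 (fun h => Bool.noConfusion (hM3 h))
          (inv_mem_iff.1 (by simpa [mul_assoc] using h))
      · simp only [tgt, if_true] at htgt
        have h := ht _ _ htgt
        rw [hnil, mul_one] at h
        exact hM1 (inv_mem_iff.1 h)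
    have hrest : ∀ (K' M : List (S × Bool)), M ≠ [] → (e, b) :: K = M ++ K' →
        (labelHom (MonoidHom.id _) f (FreeGroup.mk K')).left (t (FreeGroup.mk M)) = 1 := by
      intro K'
      induction K' with
      | nil =>
        intro M _ _
        rw [← FreeGroup.one_eq_mk, map_one]
        rfl
      | cons x K' ihK =>
        intro M hM hK
        obtain ⟨a, c⟩ := x
        rw [hvalue, hne_tgt M a c K' hM hK, ihK _ (by simp) (by simpa using hK)]
        simp
    have h1 := left_eq_one_of_mem_ratDerived_succ i (X := Multiplicative ℤ) (by
      intro x k hk hx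
      have h : k • x.toAdd = 0 := by
        rw [← toAdd_pow, hx]
        rfl
      exact toAdd_eq_zero.1 ((smul_eq_zero.1 h).resolve_left (by omega)))
        (labelHom (MonoidHom.id _) f) (fun g => labelHom_right _ _ g) hmem (t (FreeGroup.mk []))
    rw [hvalue, hrest K _ (by simp) rfl, mul_one] at h1
    have hf : f e (tgt [] e b) = Multiplicative.ofAdd 1 := if_pos ⟨rfl, rfl⟩
    rw [hf] at h1
    revert h1
    cases b <;> decide

theorem residuallyQSolvable_freeGroup (S : Type*) : ResiduallyQSolvable (FreeGroup S) := by
  classical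
  refine (Subgroup.eq_bot_iff_forall _).2 fun u hu => ?_
  by_contra hne
  rw [← FreeGroup.mk_toWord (x := u)] at hu
  refine mk_notMem_ratDerived u.toWord.length FreeGroup.isReduced_toWord ?_ le_rfl
    (Subgroup.mem_iInf.1 hu _)
  rwa [Ne, FreeGroup.toWord_eq_nil_iff]

end FreeGroups

section Main

theorem exists_ratDerived_stable {G : Type*} [Group G] (T : Finset G) :
    ∃ i, ∀ x ∈ T, x ∈ ratDerived G i → ∀ m, x ∈ ratDerived G m := by
  classical
  induction T using Finset.induction_on with
  | empty => exact ⟨0, by simp⟩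
  | insert x T _ ih =>
    obtain ⟨i, hi⟩ := ih
    obtain ⟨i', hi'⟩ : ∃ i', x ∈ ratDerived G i' → ∀ m, x ∈ ratDerived G m := by
      by_cases hx : ∀ m, x ∈ ratDerived G m
      · exact ⟨0, fun _ => hx⟩
      · obtain ⟨i', hi'⟩ := not_forall.1 hx
        exact ⟨i', fun h => absurd h hi'⟩
    refine ⟨max i i', fun y hy hyi => ?_⟩
    rcases Finset.mem_insert.1 hy with rfl | hy
    · exact hi' (ratDerived_antitone (le_max_right _ _) hyi)
    · exact hi y hy (ratDerived_antitone (le_max_left _ _) hyi)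

theorem exists_prefixWord_injOn {S : Type*} (s : ℕ → S) {n : ℕ} {w : FreeGroup S}
    (hw : w = prefixWord s n)
    (htf : ∀ g : FreeGroup S ⧸ Subgroup.normalClosure {w}, IsOfFinOrder g → g = 1) :
    ∃ i, ∀ a < n, ∀ b < n,
      ((prefixWord s a : FreeGroup S ⧸ Subgroup.normalClosure {w}) :
        (FreeGroup S ⧸ Subgroup.normalClosure {w}) ⧸
          ratDerived (FreeGroup S ⧸ Subgroup.normalClosure {w}) i) =
        ((prefixWord s b : FreeGroup S ⧸ Subgroup.normalClosure {w}) :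
        (FreeGroup S ⧸ Subgroup.normalClosure {w}) ⧸
          ratDerived (FreeGroup S ⧸ Subgroup.normalClosure {w}) i) →
          a = b := by
  classical
  let G := FreeGroup S ⧸ Subgroup.normalClosure {w}
  let γ : FreeGroup S →* G := QuotientGroup.mk' _
  let x : ℕ → ℕ → G := fun j k => γ (prefixWord s k) * (γ (prefixWord s j))⁻¹
  obtain ⟨i, hi⟩ := exists_ratDerived_stable
    ((Finset.range (n + 1) ×ˢ Finset.range (n + 1)).image fun p => x p.1 p.2)
  replace hi : ∀ j k, j ≤ n → k ≤ n → x j k ∈ ratDerived G i → ∀ m, x j k ∈ ratDerived G m := by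
    intro j k hj hk
    refine hi _ (Finset.mem_image.2 ⟨(j, k), Finset.mem_product.2 ⟨?_, ?_⟩, rfl⟩)
    · exact Finset.mem_range.2 (Nat.lt_succ_of_le hj)
    · exact Finset.mem_range.2 (Nat.lt_succ_of_le hk)
  let Q := G ⧸ ratDerived G i
  let pt : ℕ → Q := fun l => ((γ (prefixWord s l) : G) : Q)⁻¹
  have hpt : ∀ a b, pt a = pt b ↔ x a b ∈ ratDerived G i := by
    intro a b
    have hx : (γ (prefixWord s a))⁻¹⁻¹ * (γ (prefixWord s b))⁻¹ = (x a b)⁻¹ :=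
      (mul_inv_rev _ _).symm
    refine (QuotientGroup.eq (s := ratDerived G i)).trans ?_
    rw [hx, inv_mem_iff]
  suffices hgood : ∀ m j k, k - j = m → j < k → k ≤ n → k - j < n → pt j ≠ pt k by
    have hlt : ∀ a b, a < b → b < n → pt a ≠ pt b := fun a b hab hb =>
      hgood _ a b rfl hab (by omega) (by omega)
    refine ⟨i, fun a ha b hb hab => ?_⟩
    have hab' : pt a = pt b := congrArg (·⁻¹) hab
    rcases lt_trichotomy a b with h | h | h
    · exact absurd hab' (hlt a b h hb)
    · exact h
    · exact absurd hab'.symm (hlt b a h ha)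
  intro m
  induction m using Nat.strong_induction_on with
  | _ m ih =>
    rintro j k rfl hjk hkn hlt hloop
    have hne : ∀ a b, j ≤ a → a < b → b < k → pt a ≠ pt b := fun a b hja hab hbk =>
      ih (b - a) (by omega) a b rfl hab (by omega) (by omega)
    have hinj : Set.InjOn pt (Set.Ico j k) := by
      rintro a ⟨hja, hak⟩ b ⟨hjb, hbk⟩ hab
      rcases lt_trichotomy a b with h | h | h
      · exact absurd hab (hne a b hja h hbk)
      · exact h
      · exact absurd hab.symm (hne b a hjb h hak)
    have hspan := sum_single_mem_span_of_mem_ratDerived s hw i pt (fun _ => rfl) hjk.le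
      (hi j k (by omega) hkn ((hpt j k).1 hloop) (i + 1))
    have hmem : ∀ e, (∑ l ∈ Finset.Ico j k, Finsupp.single (s l, pt l) (1 : ℚ)) e ≠ 0 →
        ∃ t ∈ Set.Ico j k, (s t, pt t) = e := by
      intro e he
      rw [Finsupp.finsetSum_apply] at he
      obtain ⟨t, ht, hte⟩ := Finset.exists_ne_zero_of_sum_ne_zero he
      exact ⟨t, Finset.mem_Ico.1 ht, (Finsupp.single_apply_ne_zero.1 hte).1.symm⟩
    obtain ⟨c, hc⟩ := exists_eq_smul_pathChain s pt
      (fun P hP => isPeelable_quotient_ratDerived i P hP) (by omega) hspan (fun e he => by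
        obtain ⟨t, ⟨-, htk⟩, ht⟩ := hmem e he
        exact ⟨t, by omega, ht⟩)
    have hcoeff : (∑ l ∈ Finset.Ico j k, Finsupp.single (s l, pt l) (1 : ℚ)) (s j, pt j) = 1 := by
      rw [Finsupp.finsetSum_apply, Finset.sum_eq_single j]
      · simp
      · intro l hl hlj
        refine Finsupp.single_eq_of_ne fun h => hlj ?_
        exact (hinj (Finset.mem_Ico.1 hl) ⟨le_rfl, hjk⟩ (Prod.mk.inj h).2.symm)
      · exact fun h => absurd (Finset.mem_Ico.2 ⟨le_rfl, hjk⟩) h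
    have hc0 : c ≠ 0 := by
      rintro rfl
      rw [hc, zero_smul] at hcoeff
      exact zero_ne_one hcoeff
    have hcov : ∀ l < n, ∃ t ∈ Set.Ico j k, (s t, pt t) = (s l, pt l) := by
      intro l hl
      refine hmem _ ?_
      rw [hc]
      exact mul_ne_zero hc0 (pathChain_apply_ne_zero_iff.2 ⟨l, hl, by rw [mul_one]⟩)
    have hclosed : pt n = pt 0 := by
      have h1 : γ (prefixWord s n) = 1 :=
        (QuotientGroup.eq_one_iff _).2 (Subgroup.subset_normalClosure hw.symm)
      refine (hpt n 0).2 ?_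
      simp only [x]
      rw [h1, prefixWord, map_one, inv_one, mul_one]
      exact one_mem _
    obtain ⟨d, m, hd, hdn, hm, hpow⟩ := exists_prefixWord_eq_pow
      (fun e q => ((γ (FreeGroup.of e) : G) : Q)⁻¹ * q) (fun l => by
        simp only [pt, prefixWord, map_mul, QuotientGroup.mk_mul, mul_inv_rev])
      hjk hkn hlt hinj hloop hclosed hcov
    exact prefixWord_ne_pow hw htf hd hdn hm hpow

theorem exists_eq_prefixWord {S : Type*} {w : FreeGroup S}
    (hpos : w ∈ Submonoid.closure (Set.range (FreeGroup.of : S → FreeGroup S))) (hw : w ≠ 1) :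
    ∃ (s : ℕ → S) (n : ℕ), 0 < n ∧ w = prefixWord s n := by
  have hcongr : ∀ (s s' : ℕ → S) n, (∀ l < n, s l = s' l) → prefixWord s n = prefixWord s' n := by
    intro s s' n
    induction n with
    | zero => exact fun _ => rfl
    | succ n ih =>
      intro h
      rw [prefixWord, prefixWord, ih fun l hl => h l (by omega), h n (by omega)]
  have hne : Nonempty S := by
    by_contra h
    have := not_nonempty_iff.1 h
    exact hw (Subsingleton.elim _ _)
  suffices h : ∃ (s : ℕ → S) (n : ℕ), w = prefixWord s n by
    obtain ⟨s, n, h⟩ := h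
    refine ⟨s, n, Nat.pos_of_ne_zero ?_, h⟩
    rintro rfl
    exact hw h
  clear hw
  induction hpos using Submonoid.closure_induction_right with
  | one => exact ⟨fun _ => Classical.arbitrary S, 0, rfl⟩
  | mul_right u _ y hy ih =>
    obtain ⟨s, n, rfl⟩ := ih
    obtain ⟨e, rfl⟩ := hy
    refine ⟨Function.update s n e, n + 1, ?_⟩
    rw [prefixWord, Function.update_self]
    congr 1
    exact hcongr _ _ _ fun l hl => (Function.update_of_ne hl.ne _ _).symm

end Main

/-- A torsion-free positive one-relator group is free-by-(ℚ-solvable)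
and hence residually ℚ-solvable. -/
theorem torsionFree_positive_oneRelator {S : Type*} (w : FreeGroup S)
    (hpos : w ∈ Submonoid.closure (Set.range (FreeGroup.of : S → FreeGroup S)))
    (hw : w ≠ 1)
    (htf : ∀ g : FreeGroup S ⧸ Subgroup.normalClosure {w}, IsOfFinOrder g → g = 1) :
    (∃ (N : Subgroup (FreeGroup S ⧸ Subgroup.normalClosure {w})) (hN : N.Normal),
      IsFreeGroup N ∧
      haveI := hN
      QSolvable ((FreeGroup S ⧸ Subgroup.normalClosure {w}) ⧸ N)) ∧
    ResiduallyQSolvable (FreeGroup S ⧸ Subgroup.normalClosure {w}) := by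
  obtain ⟨s, n, hn, hws⟩ := exists_eq_prefixWord hpos hw
  obtain ⟨i, hi⟩ := exists_prefixWord_injOn s hws htf
  have hfree : IsFreeGroup (ratDerived (FreeGroup S ⧸ Subgroup.normalClosure {w}) i) :=
    isFreeGroup_of_isPeelable s hn hws _ hi fun P hP => isPeelable_quotient_ratDerived i P hP
  refine ⟨⟨ratDerived _ i, inferInstance, hfree, qSolvable_quotient_ratDerived i⟩, ?_⟩
  refine residuallyQSolvable_of_ratDerived (n := i) ?_
  exact (residuallyQSolvable_freeGroup _).of_injective (IsFreeGroup.toFreeGroup _).toMonoidHom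
    (IsFreeGroup.toFreeGroup _).injective
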